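/- The algebra Λ(1|1) = {P ∈ ℚ[u, v] : P(t, −t) is independent of t} of supersymmetric polynomials in one u-variable and one v-variable is generated as a ℚ-algebra by the elements u^{k−1}(u + v) for k ≥ 1. -/

import Mathlib

/-- A polynomial `P ∈ ℚ[u, v]` (variables `0 ↦ u`, `1 ↦ v`) is supersymmetric if
`P(t, -t)` is independent of `t`, i.e. substituting `u = t`, `v = -t` yields a constant. -/
def IsSupersymmetric (P : MvPolynomial (Fin 2) ℚ) : Prop :=
  ∃ c : ℚ,
    MvPolynomial.aeval ![(Polynomial.X : Polynomial ℚ), -Polynomial.X] P = Polynomial.C c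

open MvPolynomial in
/-- A subalgebra containing every `u ^ k * (u + v)` contains the ideal generated by `u + v`. -/
theorem pow_mul_add_mul_mem {R : Type*} [CommRing R]
    {A : Subalgebra R (MvPolynomial (Fin 2) R)}
    (hA : ∀ k : ℕ, X 0 ^ k * (X 0 + X 1) ∈ A) (Q : MvPolynomial (Fin 2) R) (k : ℕ) :
    X 0 ^ k * (X 0 + X 1) * Q ∈ A := by
  induction Q using MvPolynomial.induction_on generalizing k with
  | C a => exact A.mul_mem (hA k) (A.algebraMap_mem a)
  | add p q hp hq => rw [mul_add]; exact A.add_mem (hp k) (hq k)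
  | mul_X p i hp =>
    fin_cases i
    · convert hp (k + 1) using 1
      simp only [Fin.zero_eta]
      ring
    · convert A.sub_mem (A.mul_mem (hA 0) (hp k)) (hp (k + 1)) using 1
      simp only [Fin.mk_one]
      ring

open MvPolynomial in
/-- Modulo `u + v`, every polynomial in `u, v` is a polynomial in `u`. -/
theorem exists_eq_aeval_add_mul {R : Type*} [CommRing R] (P : MvPolynomial (Fin 2) R) :
    ∃ (f : Polynomial R) (Q : MvPolynomial (Fin 2) R),
      P = Polynomial.aeval (X 0) f + (X 0 + X 1) * Q := by
  induction P using MvPolynomial.induction_on with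
  | C a => exact ⟨Polynomial.C a, 0, by simp [MvPolynomial.algebraMap_eq]⟩
  | add p q hp hq =>
    obtain ⟨f, Q, rfl⟩ := hp
    obtain ⟨g, S, rfl⟩ := hq
    exact ⟨f + g, Q + S, by rw [map_add]; ring⟩
  | mul_X p i hp =>
    obtain ⟨f, Q, rfl⟩ := hp
    fin_cases i
    · refine ⟨f * Polynomial.X, Q * X 0, ?_⟩
      simp only [Fin.zero_eta, map_mul, Polynomial.aeval_X]
      ring
    · refine ⟨-(f * Polynomial.X), Polynomial.aeval (X 0) f + Q * X 1, ?_⟩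
      simp only [Fin.mk_one, map_neg, map_mul, Polynomial.aeval_X]
      ring

/-- `Λ(1|1)` is generated as a `ℚ`-algebra by the elements `u^{k-1}(u+v)`, `k ≥ 1`. -/
theorem stmt_11 (P : MvPolynomial (Fin 2) ℚ) :
    IsSupersymmetric P ↔
      P ∈ Algebra.adjoin ℚ
        {p : MvPolynomial (Fin 2) ℚ | ∃ k : ℕ, 1 ≤ k ∧
          p = MvPolynomial.X 0 ^ (k - 1) * (MvPolynomial.X 0 + MvPolynomial.X 1)} := by
  constructor
  · rintro ⟨c, hc⟩
    obtain ⟨f, Q, rfl⟩ := exists_eq_aeval_add_mul P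
    have hf : f = Polynomial.C c := by
      simpa [← Polynomial.aeval_algHom_apply] using hc
    rw [hf, Polynomial.aeval_C]
    refine add_mem (Subalgebra.algebraMap_mem _ c) ?_
    rw [← one_mul (MvPolynomial.X 0 + MvPolynomial.X 1), ← pow_zero (MvPolynomial.X 0)]
    refine pow_mul_add_mul_mem (fun k => Algebra.subset_adjoin ?_) Q 0
    exact ⟨k + 1, by simp, by simp⟩
  · intro hP
    induction hP using Algebra.adjoin_induction with
    | mem p hp =>
      obtain ⟨k, -, rfl⟩ := hp
      exact ⟨0, by simp⟩
    | algebraMap r => exact ⟨r, by simp [Polynomial.algebraMap_eq]⟩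
    | add p q _ _ hp hq =>
      obtain ⟨a, ha⟩ := hp
      obtain ⟨b, hb⟩ := hq
      exact ⟨a + b, by rw [map_add, ha, hb, Polynomial.C_add]⟩
    | mul p q _ _ hp hq =>
      obtain ⟨a, ha⟩ := hp
      obtain ⟨b, hb⟩ := hq
      exact ⟨a * b, by rw [map_mul, ha, hb, Polynomial.C_mul]⟩
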